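/- arXiv:1705.05006 — 2 statements merged into one kernel-verified Lean document; each statement's English description precedes it below -/
import Mathlib

section
/- The worst-case risk of the Good-Turing estimator satisfies limsup_{n→∞} n·sup_p R_n(M^GT, p) ≤ 1/4 + e^{−1}, where the supremum is over all probability mass functions p on ℕ. -/
open scoped BigOperators

noncomputable section

/-- `p` is a probability mass function on `ℕ`. -/
def IsPMF (p : ℕ → ℝ) : Prop := (∀ u, 0 ≤ p u) ∧ HasSum p 1

/-- `N_u(X^n)`: the number of appearances of the symbol `u` in the sample `x`. -/
def nOcc {n : ℕ} (x : Fin n → ℕ) (u : ℕ) : ℕ :=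
  (Finset.univ.filter fun i => x i = u).card

/-- Probability of the sample `x` under the `n`-fold product measure `p^⊗n`. -/
def sampleProb {n : ℕ} (p : ℕ → ℝ) (x : Fin n → ℕ) : ℝ := ∏ i, p (x i)

/-- Expectation of `f(X^n)` for `X^n ∼ p^⊗n`. -/
def expct (n : ℕ) (p : ℕ → ℝ) (f : (Fin n → ℕ) → ℝ) : ℝ :=
  ∑' x : Fin n → ℕ, sampleProb p x * f x

/-- The missing mass `M₀(X^n) = ∑_u p(u) 𝟙[N_u(X^n) = 0]`. -/
def missingMass {n : ℕ} (p : ℕ → ℝ) (x : Fin n → ℕ) : ℝ :=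
  ∑' u : ℕ, if nOcc x u = 0 then p u else 0

/-- `Φ_i(X^n)`: the number of symbols appearing exactly `i` times in `x` (for `i ≥ 1`). -/
def phi {n : ℕ} (i : ℕ) (x : Fin n → ℕ) : ℕ :=
  ((Finset.univ.image x).filter fun u => nOcc x u = i).card

/-- The Good-Turing estimator `M^GT(X^n) = Φ₁(X^n)/n`. -/
def goodTuring {n : ℕ} (x : Fin n → ℕ) : ℝ := (phi 1 x : ℝ) / n

/-- The squared-error risk `R_n(M̂, p) = E[(M̂(X^n) - M₀(X^n))²]`. -/
def risk (n : ℕ) (p : ℕ → ℝ) (M : (Fin n → ℕ) → ℝ) : ℝ :=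
  expct n p fun x => (M x - missingMass p x) ^ 2

/-- The worst-case risk of the Good-Turing estimator, `sup_p R_n(M^GT, p)`. -/
def gtWorstRisk (n : ℕ) : ℝ :=
  sSup {r : ℝ | ∃ p : ℕ → ℝ, IsPMF p ∧ r = risk n p goodTuring}

/-- Summation over a finite power factorises: for nonnegative summable `f i`, the sum of
`∏ i, f i (x i)` over all tuples `x` is the product of the sums. -/
theorem hasSum_pi_prod {n : ℕ} {f : Fin n → ℕ → ℝ} {S : Fin n → ℝ}
    (hf : ∀ i a, 0 ≤ f i a) (hS : ∀ i, HasSum (f i) (S i)) :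
    HasSum (fun x : Fin n → ℕ => ∏ i, f i (x i)) (∏ i, S i) := by
  induction n with
  | zero => simp
  | succ n ih =>
    have h := ih (f := fun i => f i.succ) (fun i => hf i.succ) (fun i => hS i.succ)
    have hprod := (hS 0).summable.mul_of_nonneg h.summable (hf 0)
      (fun x => Finset.prod_nonneg fun i _ => hf i.succ (x i))
    rw [Fin.prod_univ_succ, ← (Fin.consEquiv fun _ : Fin (n + 1) => ℕ).hasSum_iff]
    refine ((hS 0).mul h hprod).congr_fun ?_
    intro x
    simp [Fin.prod_univ_succ, Fin.consEquiv]

/-- Expectation of a product of nonnegative functions of the individual samples. -/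
theorem hasSum_sampleProb_mul_prod {n : ℕ} {p : ℕ → ℝ} (hp : IsPMF p) {g : Fin n → ℕ → ℝ}
    {S : Fin n → ℝ} (hg : ∀ i a, 0 ≤ g i a) (hS : ∀ i, HasSum (fun a => p a * g i a) (S i)) :
    HasSum (fun x : Fin n → ℕ => sampleProb p x * ∏ i, g i (x i)) (∏ i, S i) := by
  have h := hasSum_pi_prod (fun i a => mul_nonneg (hp.1 a) (hg i a)) hS
  simpa only [sampleProb, Finset.prod_mul_distrib] using h

/-- Indicator that `u` is absent from the sample. -/
def absent {n : ℕ} (u : ℕ) (x : Fin n → ℕ) : ℝ := if nOcc x u = 0 then 1 else 0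

/-- Indicator that `u` occurs exactly once in the sample. -/
def once {n : ℕ} (u : ℕ) (x : Fin n → ℕ) : ℝ := if nOcc x u = 1 then 1 else 0

/-- The factor at position `j` of the indicator that `u` occurs at position `i` and nowhere else. -/
def onlyAt {n : ℕ} (u : ℕ) (i j : Fin n) (a : ℕ) : ℝ :=
  if j = i then (if a = u then 1 else 0) else (if a = u then 0 else 1)

theorem absent_eq_prod {n : ℕ} (u : ℕ) (x : Fin n → ℕ) :
    absent u x = ∏ i, if x i = u then (0 : ℝ) else 1 := by
  unfold absent nOcc
  split_ifs with h
  · rw [Finset.card_eq_zero, Finset.filter_eq_empty_iff] at h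
    exact (Finset.prod_eq_one fun i hi => if_neg (h hi)).symm
  · rw [Finset.card_eq_zero, Finset.filter_eq_empty_iff] at h
    push Not at h
    obtain ⟨i, hi, hu⟩ := h
    symm
    exact Finset.prod_eq_zero (i := i) hi (if_pos hu)

theorem prod_onlyAt {n : ℕ} (u : ℕ) (i : Fin n) (x : Fin n → ℕ) :
    ∏ j, onlyAt u i j (x j) = if (Finset.univ.filter fun j => x j = u) = {i} then 1 else 0 := by
  split_ifs with h
  · refine Finset.prod_eq_one fun j _ => ?_
    have := Finset.ext_iff.1 h j
    simp only [Finset.mem_filter, Finset.mem_univ, true_and, Finset.mem_singleton] at this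
    by_cases hj : j = i <;> simp_all [onlyAt]
  · have : ∃ j, ¬(x j = u ↔ j = i) := by
      by_contra! hc
      exact h (by ext j; simpa using hc j)
    obtain ⟨j, hj⟩ := this
    refine Finset.prod_eq_zero (Finset.mem_univ j) ?_
    by_cases hji : j = i <;> simp_all [onlyAt]

theorem once_eq_sum {n : ℕ} (u : ℕ) (x : Fin n → ℕ) :
    once u x = ∑ i, ∏ j, onlyAt u i j (x j) := by
  simp only [prod_onlyAt]
  unfold once nOcc
  split_ifs with h
  · obtain ⟨i, hi⟩ := Finset.card_eq_one.1 h
    simp [hi, Finset.singleton_inj]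
  · refine (Finset.sum_eq_zero fun i _ => if_neg fun hi => h ?_).symm
    rw [hi, Finset.card_singleton]

theorem onlyAt_nonneg {n : ℕ} (u : ℕ) (i j : Fin n) (a : ℕ) : 0 ≤ onlyAt u i j a := by
  unfold onlyAt; split_ifs <;> norm_num

theorem hasSum_mul_eq {p : ℕ → ℝ} (u : ℕ) :
    HasSum (fun a => p a * if a = u then (1 : ℝ) else 0) (p u) := by
  convert hasSum_ite_eq u (p u) using 2 with a
  split_ifs with h <;> simp [h]

theorem hasSum_mul_ne {p : ℕ → ℝ} (hp : IsPMF p) (u : ℕ) :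
    HasSum (fun a => p a * if a = u then (0 : ℝ) else 1) (1 - p u) := by
  refine (hp.2.sub (hasSum_mul_eq u)).congr_fun fun a => ?_
  split_ifs <;> simp

theorem hasSum_mul_ne_ne {p : ℕ → ℝ} (hp : IsPMF p) {u v : ℕ} (huv : u ≠ v) :
    HasSum (fun a => p a * ((if a = u then (0 : ℝ) else 1) * if a = v then (0 : ℝ) else 1))
      (1 - p u - p v) := by
  refine ((hasSum_mul_ne hp u).sub (hasSum_mul_eq v)).congr_fun fun a => ?_
  by_cases h1 : a = u <;> by_cases h2 : a = v <;> simp_all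

theorem hasSum_absent {n : ℕ} {p : ℕ → ℝ} (hp : IsPMF p) (u : ℕ) :
    HasSum (fun x : Fin n → ℕ => sampleProb p x * absent u x) ((1 - p u) ^ n) := by
  simp only [absent_eq_prod]
  simpa using hasSum_sampleProb_mul_prod (n := n) hp (S := fun _ => 1 - p u)
    (fun _ a => by split_ifs <;> norm_num) (fun _ => hasSum_mul_ne hp u)

theorem hasSum_absent_mul_absent {n : ℕ} {p : ℕ → ℝ} (hp : IsPMF p) {u v : ℕ} (huv : u ≠ v) :
    HasSum (fun x : Fin n → ℕ => sampleProb p x * (absent u x * absent v x))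
      ((1 - p u - p v) ^ n) := by
  simp only [absent_eq_prod, ← Finset.prod_mul_distrib]
  simpa using hasSum_sampleProb_mul_prod (n := n) hp (S := fun _ => 1 - p u - p v)
    (fun _ a => by split_ifs <;> norm_num) (fun _ => hasSum_mul_ne_ne hp huv)

theorem prod_ite_eq_const {n : ℕ} (i : Fin n) (a b : ℝ) :
    ∏ j, (if j = i then a else b) = a * b ^ (n - 1) := by
  rw [Fintype.prod_eq_mul_prod_compl i, if_pos rfl,
    Finset.prod_congr rfl fun j hj => if_neg (by simpa using hj)]
  simp [Finset.card_compl]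

theorem hasSum_once {n : ℕ} {p : ℕ → ℝ} (hp : IsPMF p) (u : ℕ) :
    HasSum (fun x : Fin n → ℕ => sampleProb p x * once u x)
      (n * (p u * (1 - p u) ^ (n - 1))) := by
  have h : ∀ i : Fin n, HasSum (fun x : Fin n → ℕ => sampleProb p x * ∏ j, onlyAt u i j (x j))
      (p u * (1 - p u) ^ (n - 1)) := fun i => by
    rw [← prod_ite_eq_const i]
    refine hasSum_sampleProb_mul_prod hp (onlyAt_nonneg u i) fun j => ?_
    by_cases hj : j = i
    · simpa [onlyAt, hj] using hasSum_mul_eq (p := p) u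
    · simpa [onlyAt, hj] using hasSum_mul_ne hp u
  have := hasSum_sum (s := Finset.univ) fun i _ => h i
  simpa [once_eq_sum, Finset.mul_sum] using this

theorem hasSum_once_mul_absent {n : ℕ} {p : ℕ → ℝ} (hp : IsPMF p) {u v : ℕ} (huv : u ≠ v) :
    HasSum (fun x : Fin n → ℕ => sampleProb p x * (once u x * absent v x))
      (n * (p u * (1 - p u - p v) ^ (n - 1))) := by
  have h : ∀ i : Fin n, HasSum (fun x : Fin n → ℕ => sampleProb p x *
      ∏ j, (onlyAt u i j (x j) * if x j = v then 0 else 1))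
      (p u * (1 - p u - p v) ^ (n - 1)) := fun i => by
    rw [← prod_ite_eq_const i]
    refine hasSum_sampleProb_mul_prod hp (g := fun j a => onlyAt u i j a * if a = v then 0 else 1)
      (fun j a => mul_nonneg (onlyAt_nonneg u i j a) (by split_ifs <;> norm_num)) fun j => ?_
    by_cases hj : j = i
    · simp only [onlyAt, hj, if_true]
      refine (hasSum_mul_eq u).congr_fun fun a => ?_
      by_cases h1 : a = u <;> simp_all
    · simpa only [onlyAt, hj, if_false] using hasSum_mul_ne_ne hp huv
  have := hasSum_sum (s := Finset.univ) fun i _ => h i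
  simp only [Finset.prod_mul_distrib, ← Finset.mul_sum, ← Finset.sum_mul, ← once_eq_sum,
    ← absent_eq_prod, Finset.sum_const, Finset.card_univ, Fintype.card_fin, nsmul_eq_mul] at this
  rwa [mul_left_comm] at this

theorem hasSum_onlyAt_mul_onlyAt {n : ℕ} {p : ℕ → ℝ} (hp : IsPMF p) {u v : ℕ} (huv : u ≠ v)
    (i k : Fin n) :
    HasSum (fun x : Fin n → ℕ => sampleProb p x *
      ((∏ j, onlyAt u i j (x j)) * ∏ j, onlyAt v k j (x j)))
      (if i = k then 0 else p u * p v * (1 - p u - p v) ^ (n - 2)) := by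
  by_cases hik : i = k
  · subst hik
    rw [if_pos rfl]
    refine hasSum_zero.congr_fun fun x => ?_
    rw [← Finset.prod_mul_distrib, Finset.prod_eq_zero (Finset.mem_univ i), mul_zero]
    by_cases h : x i = u <;> simp_all [onlyAt]
  · have hval : ∏ j, (if j = i then p u else if j = k then p v else 1 - p u - p v) =
        p u * p v * (1 - p u - p v) ^ (n - 2) := by
      rw [Fintype.prod_eq_mul_prod_compl i, if_pos rfl, mul_assoc]
      congr 1
      have hk : k ∈ ({i}ᶜ : Finset (Fin n)) := by simpa using Ne.symm hik
      rw [← Finset.mul_prod_erase _ _ hk, if_neg (Ne.symm hik), if_pos rfl]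
      congr 1
      rw [Finset.prod_congr rfl (g := fun _ => 1 - p u - p v), Finset.prod_const,
        Finset.card_erase_of_mem hk, Finset.card_compl]
      · simp [Nat.sub_sub]
      · intro j hj
        simp only [Finset.mem_erase, Finset.mem_compl, Finset.mem_singleton] at hj
        simp [hj.1, hj.2]
    rw [if_neg hik, ← hval]
    simp only [← Finset.prod_mul_distrib]
    refine hasSum_sampleProb_mul_prod hp (g := fun j a => onlyAt u i j a * onlyAt v k j a)
      (fun j a => mul_nonneg (onlyAt_nonneg u i j a) (onlyAt_nonneg v k j a)) fun j => ?_
    by_cases hj : j = i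
    · simp only [onlyAt, hj, hik, if_true, if_false]
      refine (hasSum_mul_eq u).congr_fun fun a => ?_
      by_cases h1 : a = u <;> simp_all
    · by_cases hjk : j = k
      · simp only [onlyAt, hjk, Ne.symm hik, if_true, if_false]
        refine (hasSum_mul_eq v).congr_fun fun a => ?_
        by_cases h1 : a = v
        · simp [h1, huv.symm]
        · simp [h1]
      · simpa only [onlyAt, hj, hjk, if_false] using hasSum_mul_ne_ne hp huv

theorem hasSum_once_mul_once {n : ℕ} {p : ℕ → ℝ} (hp : IsPMF p) {u v : ℕ} (huv : u ≠ v) :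
    HasSum (fun x : Fin n → ℕ => sampleProb p x * (once u x * once v x))
      (n * (n - 1) * (p u * p v * (1 - p u - p v) ^ (n - 2))) := by
  have h := hasSum_sum (s := Finset.univ) fun (i : Fin n) _ =>
    hasSum_sum (s := Finset.univ) fun (k : Fin n) _ => hasSum_onlyAt_mul_onlyAt hp huv i k
  simp only [← Finset.mul_sum, ← Finset.sum_mul, ← once_eq_sum] at h
  convert h using 1
  have hrow : ∀ i : Fin n, ∑ k, (if i = k then 0 else p u * p v * (1 - p u - p v) ^ (n - 2)) =
      ((n : ℝ) - 1) * (p u * p v * (1 - p u - p v) ^ (n - 2)) := fun i => by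
    have : ∀ k, (if i = k then 0 else p u * p v * (1 - p u - p v) ^ (n - 2)) =
        p u * p v * (1 - p u - p v) ^ (n - 2) -
          if i = k then p u * p v * (1 - p u - p v) ^ (n - 2) else 0 := fun k => by
      split_ifs <;> ring
    simp only [this, Finset.sum_sub_distrib, Finset.sum_ite_eq, Finset.mem_univ, if_true,
      Finset.sum_const, Finset.card_univ, Fintype.card_fin, nsmul_eq_mul]
    ring
  simp only [hrow, Finset.sum_const, Finset.card_univ, Fintype.card_fin, nsmul_eq_mul]
  ring

/-- Contribution of the symbol `u` to the error of the Good-Turing estimator. -/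
def symbolError {n : ℕ} (p : ℕ → ℝ) (u : ℕ) (x : Fin n → ℕ) : ℝ :=
  once u x / n - p u * absent u x

theorem hasSum_symbolError_sq {n : ℕ} (hn : 0 < n) {p : ℕ → ℝ} (hp : IsPMF p) (u : ℕ) :
    HasSum (fun x : Fin n → ℕ => sampleProb p x * (symbolError p u x * symbolError p u x))
      (p u * (1 - p u) ^ (n - 1) / n + p u ^ 2 * (1 - p u) ^ n) := by
  have hn' : (n : ℝ) ≠ 0 := by positivity
  have h := ((hasSum_once (n := n) hp u).mul_left (1 / (n : ℝ) ^ 2)).add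
    ((hasSum_absent (n := n) hp u).mul_left (p u ^ 2))
  rw [show p u * (1 - p u) ^ (n - 1) / n + p u ^ 2 * (1 - p u) ^ n =
    1 / (n : ℝ) ^ 2 * (n * (p u * (1 - p u) ^ (n - 1))) + p u ^ 2 * (1 - p u) ^ n by field_simp]
  refine h.congr_fun fun x => ?_
  have h1 : once u x * once u x = once u x := by unfold once; split_ifs <;> simp
  have h2 : absent u x * absent u x = absent u x := by unfold absent; split_ifs <;> simp
  have h3 : once u x * absent u x = 0 := by
    unfold once absent; split_ifs with h4 h5 <;> simp_all
  unfold symbolError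
  linear_combination sampleProb p x / (n : ℝ) ^ 2 * h1 + sampleProb p x * p u ^ 2 * h2
    - 2 * sampleProb p x * p u / n * h3

theorem hasSum_symbolError_mul {n : ℕ} (hn : 2 ≤ n) {p : ℕ → ℝ} (hp : IsPMF p) {u v : ℕ}
    (huv : u ≠ v) :
    HasSum (fun x : Fin n → ℕ => sampleProb p x * (symbolError p u x * symbolError p v x))
      (p u * p v * (1 - p u - p v) ^ (n - 2) * ((p u + p v) ^ 2 - 1 / n)) := by
  obtain ⟨m, rfl⟩ := Nat.exists_eq_add_of_le' hn
  have hn' : ((m + 2 : ℕ) : ℝ) ≠ 0 := by positivity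
  have h := ((((hasSum_once_mul_once (n := m + 2) hp huv).mul_left (1 / ((m + 2 : ℕ) : ℝ) ^ 2)).sub
    ((hasSum_once_mul_absent (n := m + 2) hp huv).mul_left (p v / ((m + 2 : ℕ) : ℝ)))).sub
    ((hasSum_once_mul_absent (n := m + 2) hp huv.symm).mul_left (p u / ((m + 2 : ℕ) : ℝ)))).add
    ((hasSum_absent_mul_absent (n := m + 2) hp huv).mul_left (p u * p v))
  have hval : 1 / ((m + 2 : ℕ) : ℝ) ^ 2 * (((m + 2 : ℕ) : ℝ) * (((m + 2 : ℕ) : ℝ) - 1) *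
        (p u * p v * (1 - p u - p v) ^ (m + 2 - 2))) -
        p v / ((m + 2 : ℕ) : ℝ) * (((m + 2 : ℕ) : ℝ) * (p u * (1 - p u - p v) ^ (m + 2 - 1))) -
        p u / ((m + 2 : ℕ) : ℝ) * (((m + 2 : ℕ) : ℝ) * (p v * (1 - p v - p u) ^ (m + 2 - 1))) +
        p u * p v * (1 - p u - p v) ^ (m + 2) =
      p u * p v * (1 - p u - p v) ^ (m + 2 - 2) *
        ((p u + p v) ^ 2 - 1 / ((m + 2 : ℕ) : ℝ)) := by
    have e1 : m + 2 - 1 = m + 1 := rfl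
    have e2 : m + 2 - 2 = m := rfl
    have e3 : 1 - p v - p u = 1 - p u - p v := by ring
    rw [e1, e2, e3]
    generalize ((m + 2 : ℕ) : ℝ) = N at hn'
    field_simp
    ring
  rw [hval] at h
  refine h.congr_fun fun x => ?_
  unfold symbolError
  ring

/-- The mean of `symbolError p u * symbolError p v`. -/
def errorCov (n : ℕ) (p : ℕ → ℝ) (u v : ℕ) : ℝ :=
  if u = v then p u * (1 - p u) ^ (n - 1) / n + p u ^ 2 * (1 - p u) ^ n
  else p u * p v * (1 - p u - p v) ^ (n - 2) * ((p u + p v) ^ 2 - 1 / n)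

theorem hasSum_sum_symbolError_sq {n : ℕ} (hn : 2 ≤ n) {p : ℕ → ℝ} (hp : IsPMF p)
    (s : Finset ℕ) :
    HasSum (fun x : Fin n → ℕ => sampleProb p x * (∑ u ∈ s, symbolError p u x) ^ 2)
      (∑ u ∈ s, ∑ v ∈ s, errorCov n p u v) := by
  have h := hasSum_sum (s := s) fun u _ => hasSum_sum (s := s) fun v _ =>
    show HasSum (fun x : Fin n → ℕ => sampleProb p x * (symbolError p u x * symbolError p v x))
      (errorCov n p u v) by
      unfold errorCov
      split_ifs with huv
      · subst huv; exact hasSum_symbolError_sq (by omega) hp u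
      · exact hasSum_symbolError_mul hn hp huv
  simpa only [← Finset.mul_sum, ← Finset.sum_mul, ← sq] using h

theorem mul_one_sub_pow_le {t : ℝ} (h0 : 0 ≤ t) (h1 : t ≤ 1) (k : ℕ) :
    t * (1 - t) ^ k ≤ 1 / (k + 1) := by
  rw [le_div_iff₀ (by positivity)]
  have hsum : ∑ i ∈ Finset.range (k + 1), (1 - t) ^ i * t = 1 - (1 - t) ^ (k + 1) := by
    rw [← Finset.sum_mul]
    linear_combination -geom_sum_mul (1 - t) (k + 1)
  have hle : ∑ _i ∈ Finset.range (k + 1), (1 - t) ^ k * t ≤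
      ∑ i ∈ Finset.range (k + 1), (1 - t) ^ i * t :=
    Finset.sum_le_sum fun i hi => mul_le_mul_of_nonneg_right
      (pow_le_pow_of_le_one (by linarith) (by linarith)
        (Nat.lt_succ_iff.1 (Finset.mem_range.1 hi))) h0
  rw [Finset.sum_const, Finset.card_range, nsmul_eq_mul, hsum] at hle
  push_cast at hle
  nlinarith [pow_nonneg (sub_nonneg.2 h1) (k + 1)]

theorem sq_mul_one_sub_pow_le {t : ℝ} (h0 : 0 ≤ t) (h1 : t ≤ 1) (m : ℕ) :
    t ^ 2 * (1 - t) ^ m ≤ 4 / (m + 1) ^ 2 := by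
  have hk := mul_one_sub_pow_le h0 h1 (m / 2)
  have hcast : ((m : ℝ) + 1) / 2 ≤ (m / 2 : ℕ) + 1 := by
    have : m + 1 ≤ 2 * (m / 2 + 1) := by omega
    have : (m : ℝ) + 1 ≤ 2 * ((m / 2 : ℕ) + 1) := by exact_mod_cast this
    linarith
  have hb : t * (1 - t) ^ (m / 2) ≤ 2 / (m + 1) := by
    refine hk.trans ?_
    rw [div_le_div_iff₀ (by positivity) (by positivity)]
    linarith
  calc t ^ 2 * (1 - t) ^ m ≤ t ^ 2 * (1 - t) ^ (m / 2 * 2) := by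
        refine mul_le_mul_of_nonneg_left ?_ (sq_nonneg t)
        exact pow_le_pow_of_le_one (by linarith) (by linarith) (Nat.div_mul_le_self m 2)
    _ = (t * (1 - t) ^ (m / 2)) ^ 2 := by rw [mul_pow, pow_mul]
    _ ≤ (2 / (m + 1)) ^ 2 :=
        pow_le_pow_left₀ (mul_nonneg h0 (pow_nonneg (by linarith) _)) hb 2
    _ = 4 / (m + 1) ^ 2 := by rw [div_pow]; norm_num

theorem natCast_mul_mul_one_sub_pow_le_exp {t : ℝ} (h1 : t ≤ 1) (n : ℕ) :
    n * t * (1 - t) ^ n ≤ Real.exp (-1) := by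
  have h2 : (1 - t) ^ n ≤ Real.exp (-(n * t)) := by
    calc (1 - t) ^ n ≤ Real.exp (-t) ^ n :=
          pow_le_pow_left₀ (by linarith) (Real.one_sub_le_exp_neg t) n
      _ = Real.exp (-(n * t)) := by rw [← Real.exp_nat_mul]; ring_nf
  have h3 : n * t ≤ Real.exp (n * t - 1) := by linarith [Real.add_one_le_exp (n * t - 1)]
  calc n * t * (1 - t) ^ n ≤ Real.exp (n * t - 1) * Real.exp (-(n * t)) :=
        mul_le_mul h3 h2 (pow_nonneg (by linarith) n) (Real.exp_pos _).le
    _ = Real.exp (-1) := by rw [← Real.exp_add]; ring_nf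

theorem pow_sub_pow_le_mul {a b : ℝ} (hb : 0 ≤ b) (hab : b ≤ a) (j : ℕ) :
    a ^ (j + 1) - b ^ (j + 1) ≤ (j + 1) * (a - b) * a ^ j := by
  induction j with
  | zero => simp
  | succ j ih =>
    have h1 : b ^ (j + 1) ≤ a ^ (j + 1) := pow_le_pow_left₀ hb hab _
    have h2 := mul_le_mul_of_nonneg_left ih (hb.trans hab)
    have h3 := mul_le_mul_of_nonneg_left h1 (sub_nonneg.2 hab)
    push_cast
    have e : a ^ (j + 1 + 1) - b ^ (j + 1 + 1) =
        a * (a ^ (j + 1) - b ^ (j + 1)) + (a - b) * b ^ (j + 1) := by ring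
    rw [e]
    have e2 : a * ((j + 1) * (a - b) * a ^ j) = (j + 1) * (a - b) * a ^ (j + 1) := by ring
    linarith

/-- Avoiding two symbols is nearly as likely as avoiding each independently. -/
theorem mul_pow_sub_pow_le {s t : ℝ} (hs : 0 ≤ s) (ht : 0 ≤ t) (hst : s + t ≤ 1) (j : ℕ) :
    (1 - s) ^ (j + 1) * (1 - t) ^ (j + 1) - (1 - s - t) ^ (j + 1) ≤ 1 / (j + 1) := by
  have h := pow_sub_pow_le_mul (a := (1 - s) * (1 - t)) (b := 1 - s - t) (by linarith)
    (by nlinarith [mul_nonneg hs ht]) j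
  rw [mul_pow] at h
  refine h.trans ?_
  have h1 := mul_one_sub_pow_le hs (by linarith) j
  have h2 := mul_one_sub_pow_le ht (by linarith) j
  calc (j + 1) * ((1 - s) * (1 - t) - (1 - s - t)) * ((1 - s) * (1 - t)) ^ j
      = (j + 1) * ((s * (1 - s) ^ j) * (t * (1 - t) ^ j)) := by rw [mul_pow]; ring
    _ ≤ (j + 1) * (1 / (j + 1) * (1 / (j + 1))) := by
        refine mul_le_mul_of_nonneg_left ?_ (by positivity)
        exact mul_le_mul h1 h2 (mul_nonneg ht (pow_nonneg (by linarith) _)) (by positivity)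
    _ = 1 / (j + 1) := by field_simp

theorem IsPMF.sum_le_one {p : ℕ → ℝ} (hp : IsPMF p) (s : Finset ℕ) : ∑ u ∈ s, p u ≤ 1 :=
  sum_le_hasSum s (fun u _ => hp.1 u) hp.2

theorem IsPMF.le_one {p : ℕ → ℝ} (hp : IsPMF p) (u : ℕ) : p u ≤ 1 := by
  simpa using hp.sum_le_one {u}

theorem IsPMF.add_le_one {p : ℕ → ℝ} (hp : IsPMF p) {u v : ℕ} (huv : u ≠ v) :
    p u + p v ≤ 1 := by
  simpa [Finset.sum_pair huv] using hp.sum_le_one {u, v}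

/-- Bound on the vanishing part of the normalised cross covariances for `j + 3` samples. -/
def crossBound (j : ℕ) : ℝ := (j + 3) * (4 / (j + 2) ^ 2) + 1 / (j + 1)

theorem natCast_mul_errorCov_le {p : ℕ → ℝ} (hp : IsPMF p) (j u v : ℕ) :
    ((j + 3 : ℕ) : ℝ) * errorCov (j + 3) p u v ≤
      p u * p v * crossBound j
        - (p u * (1 - p u) ^ (j + 1)) * (p v * (1 - p v) ^ (j + 1))
        + if u = v then
            p u * (1 - p u) ^ (j + 1) + p u * (Real.exp (-1) + 1 / (j + 2)) else 0 := by
  have hu0 := hp.1 u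
  have hv0 := hp.1 v
  have hu1 := hp.le_one u
  have hN : ((j + 3 : ℕ) : ℝ) = j + 3 := by push_cast; ring
  have hc : 0 ≤ crossBound j := by unfold crossBound; positivity
  unfold errorCov
  split_ifs with huv
  · subst huv
    have hexp := natCast_mul_mul_one_sub_pow_le_exp hu1 (j + 3)
    have hw := mul_one_sub_pow_le hu0 hu1 (j + 1)
    have hw1 : (1 - p u) ^ (j + 1) ≤ 1 := pow_le_one₀ (by linarith) (by linarith)
    have hw0 : 0 ≤ (1 - p u) ^ (j + 1) := pow_nonneg (by linarith) _
    have hmono : (1 - p u) ^ (j + 2) ≤ (1 - p u) ^ (j + 1) :=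
      pow_le_pow_of_le_one (by linarith) (by linarith) (by omega)
    have e1 : j + 3 - 1 = j + 2 := rfl
    rw [e1]
    rw [hN] at hexp ⊢
    have h1 := mul_le_mul_of_nonneg_left hmono hu0
    have h2 := mul_le_mul_of_nonneg_left hexp hu0
    have h3 : (p u * (1 - p u) ^ (j + 1)) * (p u * (1 - p u) ^ (j + 1)) ≤
        p u * (1 / (j + 2)) := by
      refine mul_le_mul (mul_le_of_le_one_right hu0 hw1) ?_ (mul_nonneg hu0 hw0) hu0
      have e : ((j + 1 : ℕ) : ℝ) + 1 = j + 2 := by push_cast; ring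
      rwa [e] at hw
    have h4 := mul_nonneg (mul_nonneg hu0 hu0) hc
    have e2 : (j + 3 : ℝ) * (p u * (1 - p u) ^ (j + 2) / (j + 3) + p u ^ 2 * (1 - p u) ^ (j + 3)) =
        p u * (1 - p u) ^ (j + 2) + p u * ((j + 3) * p u * (1 - p u) ^ (j + 3)) := by
      field_simp
    rw [e2]
    linarith
  · have hsum := hp.add_le_one huv
    have h1 := sq_mul_one_sub_pow_le (add_nonneg hu0 hv0) hsum (j + 1)
    have h2 := mul_pow_sub_pow_le hu0 hv0 hsum j
    have e1 : j + 3 - 2 = j + 1 := rfl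
    have e3 : 1 - (p u + p v) = 1 - p u - p v := by ring
    rw [e3] at h1
    have h3 : (p u + p v) ^ 2 * (1 - p u - p v) ^ (j + 1) ≤ 4 / (j + 2) ^ 2 := by
      convert h1 using 3; push_cast; ring
    have h4 := mul_le_mul_of_nonneg_left h3 (show (0 : ℝ) ≤ j + 3 by positivity)
    have h5 : (j + 3 : ℝ) * ((p u + p v) ^ 2 * (1 - p u - p v) ^ (j + 1))
        - (1 - p u - p v) ^ (j + 1) ≤
        crossBound j - (1 - p u) ^ (j + 1) * (1 - p v) ^ (j + 1) := by
      unfold crossBound; linarith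
    have h6 := mul_le_mul_of_nonneg_left h5 (mul_nonneg hu0 hv0)
    rw [e1, hN]
    have e2 : (j + 3 : ℝ) * (p u * p v * (1 - p u - p v) ^ (j + 1) *
        ((p u + p v) ^ 2 - 1 / (j + 3))) =
        p u * p v * ((j + 3 : ℝ) * ((p u + p v) ^ 2 * (1 - p u - p v) ^ (j + 1))
        - (1 - p u - p v) ^ (j + 1)) := by
      field_simp
    rw [e2]
    linarith

theorem natCast_mul_sum_errorCov_le {p : ℕ → ℝ} (hp : IsPMF p) (j : ℕ) (s : Finset ℕ) :
    ((j + 3 : ℕ) : ℝ) * ∑ u ∈ s, ∑ v ∈ s, errorCov (j + 3) p u v ≤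
      1 / 4 + Real.exp (-1) + (crossBound j + 1 / (j + 2)) := by
  have h := Finset.sum_le_sum fun u (_ : u ∈ s) => Finset.sum_le_sum fun v (_ : v ∈ s) =>
    natCast_mul_errorCov_le hp j u v
  simp only [← Finset.mul_sum] at h
  refine h.trans ?_
  simp only [Finset.sum_add_distrib, Finset.sum_sub_distrib, ← Finset.sum_mul, ← Finset.mul_sum,
    Finset.sum_ite_eq, Finset.sum_ite_mem, Finset.inter_self]
  have hP := hp.sum_le_one s
  have hP0 : 0 ≤ ∑ u ∈ s, p u := Finset.sum_nonneg fun u _ => hp.1 u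
  have hc : 0 ≤ crossBound j := by unfold crossBound; positivity
  have he : 0 ≤ Real.exp (-1) + 1 / ((j : ℝ) + 2) := by positivity
  have h1 : (∑ u ∈ s, p u) * (∑ u ∈ s, p u) * crossBound j ≤ crossBound j :=
    mul_le_of_le_one_left hc (mul_le_one₀ hP hP0 hP)
  have h2 := mul_le_of_le_one_left he hP
  nlinarith [sq_nonneg ((∑ u ∈ s, p u * (1 - p u) ^ (j + 1)) - 1 / 2)]

theorem once_nonneg {n : ℕ} (u : ℕ) (x : Fin n → ℕ) : 0 ≤ once u x := by
  unfold once; split_ifs <;> norm_num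

theorem sum_once_le {n : ℕ} (x : Fin n → ℕ) (s : Finset ℕ) : ∑ u ∈ s, once u x ≤ n := by
  have h1 : ∑ u ∈ s, once u x ≤ ((∑ u ∈ s, nOcc x u : ℕ) : ℝ) := by
    rw [Nat.cast_sum]
    refine Finset.sum_le_sum fun u _ => ?_
    unfold once
    split_ifs with h
    · simp [h]
    · positivity
  have h2 : ∑ u ∈ s, nOcc x u ≤ n := by
    simp only [nOcc, Finset.card_filter]
    rw [Finset.sum_comm]
    refine (Finset.sum_le_card_nsmul _ _ 1 fun i _ => ?_).trans (by simp)
    rw [Finset.sum_ite_eq]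
    split_ifs <;> simp
  exact h1.trans (by exact_mod_cast h2)

theorem absent_nonneg {n : ℕ} (u : ℕ) (x : Fin n → ℕ) : 0 ≤ absent u x := by
  unfold absent; split_ifs <;> norm_num

theorem absent_le_one {n : ℕ} (u : ℕ) (x : Fin n → ℕ) : absent u x ≤ 1 := by
  unfold absent; split_ifs <;> norm_num

theorem hasSum_symbolError {n : ℕ} {p : ℕ → ℝ} (hp : IsPMF p) (x : Fin n → ℕ) :
    HasSum (fun u => symbolError p u x) (goodTuring x - missingMass p x) := by
  have h1 : HasSum (fun u => once u x) (phi 1 x : ℝ) := by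
    have hphi : (phi 1 x : ℝ) = ∑ u ∈ Finset.univ.image x, once u x := by
      simp [phi, once, Finset.sum_boole]
    rw [hphi]
    refine hasSum_sum_of_ne_finset_zero fun u hu => ?_
    unfold once
    refine if_neg fun h => hu ?_
    obtain ⟨i, hi⟩ := Finset.card_eq_one.1 h
    have : i ∈ Finset.univ.filter fun i => x i = u := hi ▸ Finset.mem_singleton_self i
    exact Finset.mem_image.2 ⟨i, Finset.mem_univ i, (Finset.mem_filter.1 this).2⟩
  have h2 : HasSum (fun u => p u * absent u x) (missingMass p x) := by
    have hs : Summable fun u => p u * absent u x :=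
      Summable.of_nonneg_of_le (fun u => mul_nonneg (hp.1 u) (absent_nonneg u x))
        (fun u => mul_le_of_le_one_right (hp.1 u) (absent_le_one u x)) hp.2.summable
    have hm : missingMass p x = ∑' u, p u * absent u x := by
      unfold missingMass absent
      exact tsum_congr fun u => by split_ifs <;> simp
    rw [hm]
    exact hs.hasSum
  exact (h1.div_const (n : ℝ)).sub h2

theorem sq_sum_symbolError_le_one {n : ℕ} {p : ℕ → ℝ} (hp : IsPMF p) (x : Fin n → ℕ)
    (s : Finset ℕ) : (∑ u ∈ s, symbolError p u x) ^ 2 ≤ 1 := by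
  have h1 : 0 ≤ (∑ u ∈ s, once u x) / (n : ℝ) :=
    div_nonneg (Finset.sum_nonneg fun u _ => once_nonneg u x) n.cast_nonneg
  have h2 : (∑ u ∈ s, once u x) / (n : ℝ) ≤ 1 :=
    div_le_one_of_le₀ (sum_once_le x s) n.cast_nonneg
  have h3 : 0 ≤ ∑ u ∈ s, p u * absent u x :=
    Finset.sum_nonneg fun u _ => mul_nonneg (hp.1 u) (absent_nonneg u x)
  have h4 : ∑ u ∈ s, p u * absent u x ≤ 1 :=
    (Finset.sum_le_sum fun u _ => mul_le_of_le_one_right (hp.1 u) (absent_le_one u x)).trans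
      (hp.sum_le_one s)
  simp only [symbolError, Finset.sum_sub_distrib, ← Finset.sum_div]
  rw [sq_le_one_iff_abs_le_one, abs_le]
  constructor <;> linarith

theorem sampleProb_nonneg {n : ℕ} {p : ℕ → ℝ} (hp : IsPMF p) (x : Fin n → ℕ) :
    0 ≤ sampleProb p x := Finset.prod_nonneg fun i _ => hp.1 (x i)

theorem summable_sampleProb {n : ℕ} {p : ℕ → ℝ} (hp : IsPMF p) :
    Summable (sampleProb p : (Fin n → ℕ) → ℝ) :=
  (hasSum_pi_prod (fun _ => hp.1) fun _ => hp.2).summable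

/-- The Good-Turing risk is the limit of the contributions of the first `K` symbols. -/
theorem tendsto_sum_errorCov {n : ℕ} (hn : 2 ≤ n) {p : ℕ → ℝ} (hp : IsPMF p) :
    Filter.Tendsto
      (fun K => ∑ u ∈ Finset.range K, ∑ v ∈ Finset.range K, errorCov n p u v)
      Filter.atTop (nhds (risk n p goodTuring)) := by
  simp only [← (hasSum_sum_symbolError_sq hn hp _).tsum_eq]
  refine tendsto_tsum_of_dominated_convergence (summable_sampleProb hp) (fun x => ?_)
    (Filter.Eventually.of_forall fun K x => ?_)
  · exact ((hasSum_symbolError hp x).tendsto_sum_nat.pow 2).const_mul _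
  · rw [Real.norm_of_nonneg (mul_nonneg (sampleProb_nonneg hp x) (sq_nonneg _))]
    exact mul_le_of_le_one_right (sampleProb_nonneg hp x) (sq_sum_symbolError_le_one hp x _)

theorem natCast_mul_risk_le {p : ℕ → ℝ} (hp : IsPMF p) (j : ℕ) :
    ((j + 3 : ℕ) : ℝ) * risk (j + 3) p goodTuring ≤
      1 / 4 + Real.exp (-1) + (crossBound j + 1 / (j + 2)) :=
  le_of_tendsto' ((tendsto_sum_errorCov (by omega) hp).const_mul _)
    fun K => natCast_mul_sum_errorCov_le hp j (Finset.range K)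

theorem natCast_mul_gtWorstRisk_le (j : ℕ) :
    ((j + 3 : ℕ) : ℝ) * gtWorstRisk (j + 3) ≤
      1 / 4 + Real.exp (-1) + (crossBound j + 1 / (j + 2)) := by
  have hN : (0 : ℝ) < ((j + 3 : ℕ) : ℝ) := by positivity
  rw [mul_comm, ← le_div_iff₀ hN]
  refine Real.sSup_le ?_ (by unfold crossBound; positivity)
  rintro r ⟨p, hp, rfl⟩
  rw [le_div_iff₀ hN, mul_comm]
  exact natCast_mul_risk_le hp j

theorem gtWorstRisk_nonneg (n : ℕ) : 0 ≤ gtWorstRisk n := by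
  refine Real.sSup_nonneg ?_
  rintro r ⟨p, hp, rfl⟩
  exact tsum_nonneg fun x => mul_nonneg (sampleProb_nonneg hp x) (sq_nonneg _)

theorem tendsto_crossBound : Filter.Tendsto crossBound Filter.atTop (nhds 0) := by
  have h : Filter.Tendsto (fun j : ℕ => 13 * (1 / ((j : ℝ) + 1))) Filter.atTop (nhds 0) := by
    simpa using tendsto_one_div_add_atTop_nhds_zero_nat (𝕜 := ℝ).const_mul 13
  refine squeeze_zero (fun j => by unfold crossBound; positivity) (fun j => ?_) h
  have hj : (0 : ℝ) ≤ j := j.cast_nonneg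
  have : ((j : ℝ) + 3) * (4 / (j + 2) ^ 2) ≤ 12 * (1 / (j + 1)) := by
    rw [mul_div_assoc', mul_one_div, div_le_div_iff₀ (by positivity) (by positivity)]
    nlinarith
  unfold crossBound
  linarith

/-- **Upper bound (13) on the worst-case risk of the Good-Turing estimator:**
`limsup_{n→∞} n · sup_p R_n(M^GT, p) ≤ 1/4 + e⁻¹`. -/
theorem goodTuring_worst_risk_limsup_le :
    Filter.limsup (fun n : ℕ => (n : ℝ) * gtWorstRisk n) Filter.atTop ≤
      1 / 4 + Real.exp (-1) := by
  have h2 : Filter.Tendsto (fun j : ℕ => 1 / ((j : ℝ) + 2)) Filter.atTop (nhds 0) := by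
    refine squeeze_zero (fun j => by positivity) (fun j => ?_)
      (tendsto_one_div_add_atTop_nhds_zero_nat (𝕜 := ℝ))
    gcongr
    norm_num
  have hlim : Filter.Tendsto
      (fun j : ℕ => 1 / 4 + Real.exp (-1) + (crossBound j + 1 / ((j : ℝ) + 2)))
      Filter.atTop (nhds (1 / 4 + Real.exp (-1))) := by
    simpa using (tendsto_crossBound.add h2).const_add (1 / 4 + Real.exp (-1))
  rw [← Filter.limsup_nat_add _ 3, ← hlim.limsup_eq]
  refine Filter.limsup_le_limsup (Filter.Eventually.of_forall natCast_mul_gtWorstRisk_le) ?_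
    hlim.isBoundedUnder_le
  exact Filter.isCoboundedUnder_le_of_le Filter.atTop (x := 0) fun j =>
    mul_nonneg (Nat.cast_nonneg _) (gtWorstRisk_nonneg _)
end
end

section
/- The worst-case risk of the Good-Turing estimator satisfies 0.608 ≤ liminf_{n→∞} n·sup_p R_n(M^GT, p) and limsup_{n→∞} n·sup_p R_n(M^GT, p) ≤ 0.6179, where the supremum is over all probability mass functions p on ℕ. -/
open scoped BigOperators

noncomputable section

theorem hasSum_pi_prod_of_nonneg {n : ℕ} (f : Fin n → ℕ → ℝ) (s : Fin n → ℝ)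
    (h0 : ∀ i a, 0 ≤ f i a) (h : ∀ i, HasSum (f i) (s i)) :
    HasSum (fun x : Fin n → ℕ => ∏ i, f i (x i)) (∏ i, s i) := by
  induction n with
  | zero => simp
  | succ n ih =>
    have ih' := ih (fun i => f i.succ) (fun i => s i.succ) (fun i a => h0 _ _) (fun i => h _)
    have hs := (h 0).summable.mul_of_nonneg ih'.summable (fun a => h0 _ _)
      (fun x => Finset.prod_nonneg fun i _ => h0 _ _)
    rw [← (Fin.consEquiv (fun _ : Fin (n + 1) => ℕ)).hasSum_iff, Fin.prod_univ_succ]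
    refine ((h 0).mul ih' hs).congr_fun fun y => ?_
    exact Fin.prod_univ_succ fun i => f i ((Fin.consEquiv fun _ => ℕ) y i)

/-- The set of positions at which the symbol `u` appears in `x`. -/
def occ {n : ℕ} (x : Fin n → ℕ) (u : ℕ) : Finset (Fin n) :=
  Finset.univ.filter fun i => x i = u

theorem nOcc_eq_card_occ {n : ℕ} (x : Fin n → ℕ) (u : ℕ) : nOcc x u = (occ x u).card := rfl

theorem hasSum_mul_ite_eq (p : ℕ → ℝ) (u : ℕ) :
    HasSum (fun a => p a * if a = u then 1 else 0) (p u) := by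
  refine (hasSum_ite_eq u (p u)).congr_fun ?_
  intro a
  by_cases h : a = u <;> simp [h]

namespace IsPMF

variable {p : ℕ → ℝ}

theorem hasSum_ne (hp : IsPMF p) (u : ℕ) :
    HasSum (fun a => p a * if a ≠ u then 1 else 0) (1 - p u) := by
  refine (hp.2.sub (hasSum_mul_ite_eq p u)).congr_fun ?_
  intro a
  by_cases h : a = u <;> simp [h]

theorem hasSum_ne_ne (hp : IsPMF p) {u v : ℕ} (huv : u ≠ v) :
    HasSum (fun a => p a * if a ≠ u ∧ a ≠ v then 1 else 0) (1 - p u - p v) := by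
  refine ((hp.2.sub (hasSum_mul_ite_eq p u)).sub (hasSum_mul_ite_eq p v)).congr_fun ?_
  intro a
  by_cases h : a = u
  · subst h; simp [huv]
  · by_cases h' : a = v <;> simp [h, h', huv.symm]

theorem le_one_s12 (hp : IsPMF p) (u : ℕ) : p u ≤ 1 := le_hasSum hp.2 u fun v _ => hp.1 v

theorem add_le_one_s12 (hp : IsPMF p) {u v : ℕ} (huv : u ≠ v) : p u + p v ≤ 1 := by
  simpa [Finset.sum_pair huv] using sum_le_hasSum {u, v} (fun w _ => hp.1 w) hp.2

theorem hasSum_sampleProb (hp : IsPMF p) (n : ℕ) :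
    HasSum (fun x : Fin n → ℕ => sampleProb p x) 1 := by
  simpa [sampleProb] using hasSum_pi_prod_of_nonneg (fun _ : Fin n => p) (fun _ => 1) (fun _ => hp.1)
    (fun _ => hp.2)

/-- The law of the set of positions of the symbol `u`. -/
theorem hasSum_occ_eq (hp : IsPMF p) {n : ℕ} (u : ℕ) (S : Finset (Fin n)) :
    HasSum (fun x : Fin n → ℕ => sampleProb p x * if occ x u = S then 1 else 0)
      (p u ^ S.card * (1 - p u) ^ (n - S.card)) := by
  have h := hasSum_pi_prod_of_nonneg
    (fun (j : Fin n) a => p a * if j ∈ S then (if a = u then 1 else 0) else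
      (if a ≠ u then 1 else 0)) (fun j => if j ∈ S then p u else 1 - p u)
    (fun j a => mul_nonneg (hp.1 a) (by split_ifs <;> norm_num))
    (fun j => by
      by_cases hS : j ∈ S
      · simpa only [hS, if_true] using hasSum_mul_ite_eq p u
      · simpa only [hS, if_false] using hp.hasSum_ne u)
  convert h using 1
  · funext x
    rw [Finset.prod_mul_distrib, sampleProb]
    congr 1
    have : ∀ j, (if j ∈ S then (if x j = u then (1 : ℝ) else 0) else (if x j ≠ u then 1 else 0))
        = if (x j = u ↔ j ∈ S) then 1 else 0 := by
      intro j
      by_cases h1 : j ∈ S <;> by_cases h2 : x j = u <;> simp [h1, h2]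
    simp only [this, Finset.prod_ite_zero, Finset.prod_const_one, occ, Finset.ext_iff,
      Finset.mem_filter, Finset.mem_univ, true_and, true_imp_iff]
  · rw [Finset.prod_ite, Finset.prod_const, Finset.prod_const, Finset.filter_not,
      Finset.filter_mem_eq_inter, Finset.univ_inter, Finset.card_sdiff_of_subset (by simp)]
    simp

/-- The joint law of the sets of positions of two distinct symbols. -/
theorem hasSum_occ_eq_and (hp : IsPMF p) {n : ℕ} {u v : ℕ} (huv : u ≠ v) {S T : Finset (Fin n)}
    (hST : Disjoint S T) :
    HasSum (fun x : Fin n → ℕ => sampleProb p x * if occ x u = S ∧ occ x v = T then 1 else 0)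
      (p u ^ S.card * p v ^ T.card * (1 - p u - p v) ^ (n - S.card - T.card)) := by
  have hd : ∀ j, j ∈ S → j ∉ T := fun j hj => Finset.disjoint_left.1 hST hj
  have h := hasSum_pi_prod_of_nonneg
    (fun (j : Fin n) a => p a * if j ∈ S then (if a = u then 1 else 0) else
      if j ∈ T then (if a = v then 1 else 0) else (if a ≠ u ∧ a ≠ v then 1 else 0))
    (fun j => if j ∈ S then p u else if j ∈ T then p v else 1 - p u - p v)
    (fun j a => mul_nonneg (hp.1 a) (by split_ifs <;> norm_num))
    (fun j => by
      by_cases hS : j ∈ S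
      · simpa only [hS, if_true] using hasSum_mul_ite_eq p u
      · by_cases hT : j ∈ T
        · simpa only [hS, hT, if_true, if_false] using hasSum_mul_ite_eq p v
        · simpa only [hS, hT, if_false] using hp.hasSum_ne_ne huv)
  convert h using 1
  · funext x
    rw [Finset.prod_mul_distrib, sampleProb]
    congr 1
    have : ∀ j, (if j ∈ S then (if x j = u then (1 : ℝ) else 0) else
        if j ∈ T then (if x j = v then 1 else 0) else (if x j ≠ u ∧ x j ≠ v then 1 else 0))
        = if (x j = u ↔ j ∈ S) ∧ (x j = v ↔ j ∈ T) then 1 else 0 := by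
      intro j
      have := hd j
      by_cases h1 : j ∈ S <;> by_cases h2 : j ∈ T <;> by_cases h3 : x j = u <;>
        by_cases h4 : x j = v <;> simp_all
    simp only [this, Finset.prod_ite_zero, Finset.prod_const_one, occ, Finset.ext_iff,
      Finset.mem_filter, Finset.mem_univ, true_and, true_imp_iff, forall_and]
  · have hsub : T ⊆ Finset.univ \ S := fun j hj => by
      simpa using fun h' => hd j h' hj
    rw [Finset.prod_ite, Finset.prod_const, Finset.filter_not, Finset.filter_mem_eq_inter,
      Finset.univ_inter, Finset.prod_ite, Finset.prod_const, Finset.prod_const, Finset.filter_not,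
      Finset.filter_mem_eq_inter, Finset.inter_eq_right.2 hsub, Finset.card_sdiff_of_subset hsub,
      Finset.card_sdiff_of_subset (by simp)]
    simp [mul_assoc]

end IsPMF

/-- Indicator that the symbol `u` appears exactly `k` times in `x`. -/
def occInd {n : ℕ} (k : ℕ) (x : Fin n → ℕ) (u : ℕ) : ℝ := if nOcc x u = k then 1 else 0

theorem occInd_nonneg {n : ℕ} (k : ℕ) (x : Fin n → ℕ) (u : ℕ) : 0 ≤ occInd k x u := by
  unfold occInd; split_ifs <;> norm_num

theorem occInd_zero {n : ℕ} (x : Fin n → ℕ) (u : ℕ) :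
    occInd 0 x u = if occ x u = ∅ then 1 else 0 := by
  simp [occInd, nOcc_eq_card_occ]

theorem occInd_one {n : ℕ} (x : Fin n → ℕ) (u : ℕ) :
    occInd 1 x u = ∑ i, if occ x u = {i} then 1 else 0 := by
  unfold occInd
  rw [nOcc_eq_card_occ]
  split_ifs with h
  · obtain ⟨i, hi⟩ := Finset.card_eq_one.1 h
    simp [hi]
  · refine (Finset.sum_eq_zero fun i _ => if_neg fun hi => h ?_).symm
    simp [hi]

theorem occ_disjoint {n : ℕ} (x : Fin n → ℕ) {u v : ℕ} (huv : u ≠ v) :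
    Disjoint (occ x u) (occ x v) := by
  refine Finset.disjoint_left.2 fun i hi hj => huv ?_
  simp only [occ, Finset.mem_filter, Finset.mem_univ, true_and] at hi hj
  exact hi.symm.trans hj

namespace IsPMF

variable {p : ℕ → ℝ}

theorem hasSum_occInd_zero (hp : IsPMF p) (n u : ℕ) :
    HasSum (fun x : Fin n → ℕ => sampleProb p x * occInd 0 x u) ((1 - p u) ^ n) := by
  simpa [occInd_zero] using hp.hasSum_occ_eq (n := n) u ∅

theorem hasSum_occInd_one (hp : IsPMF p) (n u : ℕ) :
    HasSum (fun x : Fin n → ℕ => sampleProb p x * occInd 1 x u)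
      (n * (p u * (1 - p u) ^ (n - 1))) := by
  have := hasSum_sum fun (i : Fin n) (_ : i ∈ Finset.univ) => hp.hasSum_occ_eq u {i}
  simp only [← Finset.mul_sum, ← occInd_one] at this
  simpa using this

theorem hasSum_occInd_zero_zero (hp : IsPMF p) (n : ℕ) {u v : ℕ} (huv : u ≠ v) :
    HasSum (fun x : Fin n → ℕ => sampleProb p x * (occInd 0 x u * occInd 0 x v))
      ((1 - p u - p v) ^ n) := by
  have := hp.hasSum_occ_eq_and (n := n) huv (Finset.disjoint_empty_left ∅)
  simpa only [occInd_zero, ite_zero_mul_ite_zero, mul_one, Finset.card_empty, pow_zero, one_mul,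
    Nat.sub_zero] using this

theorem hasSum_occInd_one_zero (hp : IsPMF p) (n : ℕ) {u v : ℕ} (huv : u ≠ v) :
    HasSum (fun x : Fin n → ℕ => sampleProb p x * (occInd 1 x u * occInd 0 x v))
      (n * (p u * (1 - p u - p v) ^ (n - 1))) := by
  have := hasSum_sum fun (i : Fin n) (_ : i ∈ Finset.univ) =>
    hp.hasSum_occ_eq_and huv (Finset.disjoint_empty_right {i})
  simp only [← Finset.mul_sum] at this
  convert this using 1
  · funext x
    simp only [occInd_zero, occInd_one, Finset.sum_mul, ite_zero_mul_ite_zero, mul_one]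
  · simp

theorem hasSum_occInd_one_one (hp : IsPMF p) (n : ℕ) {u v : ℕ} (huv : u ≠ v) :
    HasSum (fun x : Fin n → ℕ => sampleProb p x * (occInd 1 x u * occInd 1 x v))
      (n * (n - 1) * (p u * p v * (1 - p u - p v) ^ (n - 2))) := by
  have := hasSum_sum fun (i : Fin n) (_ : i ∈ Finset.univ) =>
    hasSum_sum fun (j : Fin n) (_ : j ∈ Finset.univ) =>
    show HasSum (fun x : Fin n → ℕ => sampleProb p x *
      if occ x u = {i} ∧ occ x v = {j} then 1 else 0)
      (if i = j then 0 else p u * p v * (1 - p u - p v) ^ (n - 2)) by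
    by_cases hij : i = j
    · subst hij
      simp only [if_true]
      convert hasSum_zero using 2 with x
      rw [if_neg, mul_zero]
      rintro ⟨h1, h2⟩
      simpa [h1, h2] using occ_disjoint x huv
    · simpa [hij, Nat.sub_sub] using hp.hasSum_occ_eq_and huv
        (Finset.disjoint_singleton.2 hij)
  convert this using 1
  · funext x
    rw [occInd_one, occInd_one, Finset.sum_mul_sum]
    simp only [Finset.mul_sum, ite_zero_mul_ite_zero, mul_one]
  · have : ∀ (i : Fin n) (c : ℝ), ∑ j, (if i = j then 0 else c) = (n - 1) * c := by
      intro i c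
      have : ∀ j, (if i = j then 0 else c) = c - if i = j then c else 0 := by
        intro j; split_ifs <;> simp
      simp [this, Finset.sum_sub_distrib, sub_mul]
    simp [this, mul_assoc]

end IsPMF

theorem hasSum_occInd_one_phi {n : ℕ} (x : Fin n → ℕ) :
    HasSum (fun u => occInd 1 x u) (phi 1 x : ℝ) := by
  have h := hasSum_sum_of_ne_finset_zero (f := fun u => occInd 1 x u)
    (s := Finset.univ.image x) (L := .unconditional ℕ) (fun u hu => by
      refine if_neg fun h => hu ?_
      obtain ⟨i, hi⟩ := Finset.card_pos.1 (h ▸ one_pos : 0 < nOcc x u)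
      exact Finset.mem_image.2 ⟨i, Finset.mem_univ _, (Finset.mem_filter.1 hi).2⟩)
  have hphi : (phi 1 x : ℝ) = ∑ u ∈ Finset.univ.image x, occInd 1 x u := by
    simp [occInd, phi]
  rwa [hphi]

theorem goodTuring_nonneg {n : ℕ} (x : Fin n → ℕ) : 0 ≤ goodTuring x := by
  unfold goodTuring; positivity

theorem goodTuring_le_one {n : ℕ} (x : Fin n → ℕ) : goodTuring x ≤ 1 := by
  refine div_le_one_of_le₀ (Nat.cast_le.2 ?_) n.cast_nonneg
  calc phi 1 x ≤ (Finset.univ.image x).card := Finset.card_filter_le _ _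
    _ ≤ (Finset.univ : Finset (Fin n)).card := Finset.card_image_le
    _ = n := by simp

namespace IsPMF

variable {p : ℕ → ℝ}

theorem hasSum_missingMass (hp : IsPMF p) {n : ℕ} (x : Fin n → ℕ) :
    HasSum (fun u => p u * occInd 0 x u) (missingMass p x) := by
  have : (fun u => p u * occInd 0 x u) = fun u => if nOcc x u = 0 then p u else 0 := by
    funext u; simp [occInd]
  rw [this, missingMass]
  refine (Summable.of_nonneg_of_le (fun u => ?_) (fun u => ?_) hp.2.summable).hasSum
  · split_ifs
    exacts [hp.1 u, le_rfl]
  · split_ifs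
    exacts [le_rfl, hp.1 u]

theorem missingMass_nonneg (hp : IsPMF p) {n : ℕ} (x : Fin n → ℕ) : 0 ≤ missingMass p x :=
  (hp.hasSum_missingMass x).nonneg fun u => mul_nonneg (hp.1 u) (occInd_nonneg 0 x u)

theorem missingMass_le_one (hp : IsPMF p) {n : ℕ} (x : Fin n → ℕ) : missingMass p x ≤ 1 :=
  hasSum_le (fun u => mul_le_of_le_one_right (hp.1 u) (by unfold occInd; split_ifs <;> norm_num))
    (hp.hasSum_missingMass x) hp.2

theorem sampleProb_nonneg (hp : IsPMF p) {n : ℕ} (x : Fin n → ℕ) : 0 ≤ sampleProb p x :=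
  Finset.prod_nonneg fun _ _ => hp.1 _

end IsPMF

/-- The contribution of the symbol `u` to the error of the Good-Turing estimator. -/
def gtErr {n : ℕ} (p : ℕ → ℝ) (x : Fin n → ℕ) (u : ℕ) : ℝ :=
  occInd 1 x u / n - p u * occInd 0 x u

/-- The contribution of the pair of symbols `w` to the risk of the Good-Turing estimator. -/
def gtCov (n : ℕ) (p : ℕ → ℝ) (w : ℕ × ℕ) : ℝ :=
  if w.1 = w.2 then p w.1 * (1 - p w.1) ^ (n - 1) / n + p w.1 ^ 2 * (1 - p w.1) ^ n
  else p w.1 * p w.2 * (1 - p w.1 - p w.2) ^ (n - 2) * ((p w.1 + p w.2) ^ 2 - 1 / n)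

namespace IsPMF

variable {p : ℕ → ℝ}

theorem hasSum_gtErr (hp : IsPMF p) {n : ℕ} (x : Fin n → ℕ) :
    HasSum (gtErr p x) (goodTuring x - missingMass p x) :=
  ((hasSum_occInd_one_phi x).div_const _).sub (hp.hasSum_missingMass x)

theorem hasSum_gtErr_mul_gtErr (hp : IsPMF p) {n : ℕ} (hn : 2 ≤ n) (w : ℕ × ℕ) :
    HasSum (fun x : Fin n → ℕ => sampleProb p x * (gtErr p x w.1 * gtErr p x w.2))
      (gtCov n p w) := by
  obtain ⟨m, rfl⟩ : ∃ m, n = m + 2 := ⟨n - 2, by omega⟩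
  obtain ⟨u, v⟩ := w
  have hn0 : ((m + 2 : ℕ) : ℝ) ≠ 0 := by positivity
  by_cases huv : u = v
  · subst huv
    have hval : gtCov (m + 2) p (u, u) = (m + 2 : ℕ) * (p u * (1 - p u) ^ (m + 2 - 1)) /
        ((m + 2 : ℕ) : ℝ) ^ 2 + p u ^ 2 * (1 - p u) ^ (m + 2) := by
      simp only [gtCov, if_true]
      field_simp
    rw [hval]
    refine (((hp.hasSum_occInd_one (m + 2) u).div_const (((m + 2 : ℕ) : ℝ) ^ 2)).add
      ((hp.hasSum_occInd_zero (m + 2) u).mul_left (p u ^ 2))).congr_fun fun x => ?_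
    have h1 : occInd 1 x u * occInd 0 x u = 0 := by
      unfold occInd; split_ifs <;> simp_all
    have h2 : ∀ k, occInd k x u * occInd k x u = occInd k x u := by
      intro k; unfold occInd; split_ifs <;> simp
    unfold gtErr
    field_simp
    linear_combination sampleProb p x * (h2 1 + ((m + 2 : ℕ) : ℝ) ^ 2 * p u ^ 2 * h2 0
      - 2 * ((m + 2 : ℕ) : ℝ) * p u * h1)
  · have hval : gtCov (m + 2) p (u, v) = (m + 2 : ℕ) * ((m + 2 : ℕ) - 1) *
        (p u * p v * (1 - p u - p v) ^ (m + 2 - 2)) / ((m + 2 : ℕ) : ℝ) ^ 2 -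
        (p v / (m + 2 : ℕ) * ((m + 2 : ℕ) * (p u * (1 - p u - p v) ^ (m + 2 - 1))) +
          p u / (m + 2 : ℕ) * ((m + 2 : ℕ) * (p v * (1 - p v - p u) ^ (m + 2 - 1)))) +
        p u * p v * (1 - p u - p v) ^ (m + 2) := by
      simp only [gtCov, if_neg huv, Nat.add_sub_cancel, show m + 2 - 1 = m + 1 by omega, pow_succ]
      rw [sub_right_comm 1 (p v) (p u)]
      field_simp
      ring
    rw [hval]
    refine ((((hp.hasSum_occInd_one_one (m + 2) huv).div_const (((m + 2 : ℕ) : ℝ) ^ 2)).sub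
      (((hp.hasSum_occInd_one_zero (m + 2) huv).mul_left (p v / (m + 2 : ℕ))).add
      ((hp.hasSum_occInd_one_zero (m + 2) (Ne.symm huv)).mul_left (p u / (m + 2 : ℕ))))).add
      ((hp.hasSum_occInd_zero_zero (m + 2) huv).mul_left (p u * p v))).congr_fun fun x => ?_
    unfold gtErr
    field_simp
    ring

theorem hasSum_gtCov (hp : IsPMF p) {n : ℕ} (hn : 2 ≤ n) :
    HasSum (gtCov n p) (risk n p goodTuring) := by
  have hbound : Summable fun q : (Fin n → ℕ) × (ℕ × ℕ) => sampleProb p q.1 *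
      ((occInd 1 q.1 q.2.1 / n + p q.2.1 * occInd 0 q.1 q.2.1) *
        (occInd 1 q.1 q.2.2 / n + p q.2.2 * occInd 0 q.1 q.2.2)) := by
    have h0 : ∀ (x : Fin n → ℕ) u, 0 ≤ occInd 1 x u / n + p u * occInd 0 x u := fun x u =>
      add_nonneg (div_nonneg (occInd_nonneg _ _ _) n.cast_nonneg)
        (mul_nonneg (hp.1 u) (occInd_nonneg _ _ _))
    have hs : ∀ x : Fin n → ℕ, HasSum (fun w : ℕ × ℕ => sampleProb p x *
        ((occInd 1 x w.1 / n + p w.1 * occInd 0 x w.1) *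
        (occInd 1 x w.2 / n + p w.2 * occInd 0 x w.2)))
        (sampleProb p x * ((goodTuring x + missingMass p x) * (goodTuring x + missingMass p x))) := by
      intro x
      have h := ((hasSum_occInd_one_phi x).div_const (n : ℝ)).add (hp.hasSum_missingMass x)
      exact (h.mul h (h.summable.mul_of_nonneg h.summable (h0 x) (h0 x))).mul_left _
    rw [summable_prod_of_nonneg fun q => mul_nonneg (hp.sampleProb_nonneg _)
      (mul_nonneg (h0 _ _) (h0 _ _))]
    refine ⟨fun x => (hs x).summable, ?_⟩
    simp only [(hs _).tsum_eq]
    refine Summable.of_nonneg_of_le (fun x => ?_) (fun x => ?_)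
      ((hp.hasSum_sampleProb n).summable.mul_right 4)
    · exact mul_nonneg (hp.sampleProb_nonneg x) (mul_self_nonneg _)
    · refine mul_le_mul_of_nonneg_left ?_ (hp.sampleProb_nonneg x)
      nlinarith [goodTuring_nonneg x, goodTuring_le_one x, hp.missingMass_nonneg x,
        hp.missingMass_le_one x]
  have hsum : Summable fun q : (Fin n → ℕ) × (ℕ × ℕ) => sampleProb p q.1 *
      (gtErr p q.1 q.2.1 * gtErr p q.1 q.2.2) := by
    refine Summable.of_norm_bounded hbound fun q => ?_
    have h0 : ∀ (x : Fin n → ℕ) u, |gtErr p x u| ≤ occInd 1 x u / n + p u * occInd 0 x u := by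
      intro x u
      refine (abs_sub _ _).trans_eq ?_
      rw [abs_of_nonneg (div_nonneg (occInd_nonneg _ _ _) n.cast_nonneg),
        abs_of_nonneg (mul_nonneg (hp.1 u) (occInd_nonneg _ _ _))]
    rw [Real.norm_eq_abs, abs_mul, abs_mul, abs_of_nonneg (hp.sampleProb_nonneg _)]
    exact mul_le_mul_of_nonneg_left (mul_le_mul (h0 _ _) (h0 _ _) (abs_nonneg _)
      ((abs_nonneg _).trans (h0 _ _))) (hp.sampleProb_nonneg _)
  have h1 := hsum.hasSum.prod_fiberwise (g := fun x : Fin n → ℕ =>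
    sampleProb p x * (goodTuring x - missingMass p x) ^ 2) fun x => by
      have h := hp.hasSum_gtErr x
      rw [sq]
      refine (h.mul h ?_).mul_left _
      exact summable_mul_of_summable_norm h.summable.norm h.summable.norm
  have h2 := ((Equiv.prodComm _ _).hasSum_iff.2 hsum.hasSum).prod_fiberwise
    fun w => hp.hasSum_gtErr_mul_gtErr hn w
  rw [risk, expct, h1.tsum_eq]
  exact h2

end IsPMF

theorem hasSum_diag {g : ℕ → ℝ} {a : ℝ} (hg : HasSum g a) :
    HasSum (fun w : ℕ × ℕ => if w.1 = w.2 then g w.1 else 0) a := by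
  have hinj : Function.Injective fun u : ℕ => (u, u) := fun u v h => (Prod.ext_iff.1 h).1
  rw [← hinj.hasSum_iff]
  · simpa [Function.comp_def] using hg
  · rintro ⟨u, v⟩ h
    refine if_neg fun h' : u = v => h ⟨u, by rw [← h']⟩

theorem mul_exp_neg_le_one {y : ℝ} : y * Real.exp (-y) ≤ 1 := by
  rw [Real.exp_neg, ← div_eq_mul_inv, div_le_one (Real.exp_pos y)]
  linarith [Real.add_one_le_exp y]

theorem sq_mul_exp_neg_le_two {y : ℝ} (hy : 0 ≤ y) : y ^ 2 * Real.exp (-y) ≤ 2 := by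
  rw [Real.exp_neg, ← div_eq_mul_inv, div_le_iff₀ (Real.exp_pos y)]
  linarith [Real.quadratic_le_exp_of_nonneg hy]

theorem one_sub_pow_le_exp {s : ℝ} (hs : s ≤ 1) (m : ℕ) : (1 - s) ^ m ≤ Real.exp (-(m * s)) := by
  rw [← mul_neg, Real.exp_nat_mul]
  exact pow_le_pow_left₀ (sub_nonneg.2 hs) (Real.one_sub_le_exp_neg s) m

theorem exp_mul_one_sub_le_one_sub_pow {s : ℝ} (h0 : 0 ≤ s) (hs : s ≤ 1) (m : ℕ) :
    Real.exp (-(m * s)) * (1 - m * s ^ 2) ≤ (1 - s) ^ m := by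
  have h1 : 1 - m * s ^ 2 ≤ ((1 - s) * Real.exp s) ^ m := by
    have hb := one_add_mul_le_pow (a := -s ^ 2) (by nlinarith) m
    calc 1 - m * s ^ 2 = 1 + m * -s ^ 2 := by ring
      _ ≤ (1 + -s ^ 2) ^ m := hb
      _ ≤ _ := by
        refine pow_le_pow_left₀ (by nlinarith) ?_ m
        nlinarith [Real.add_one_le_exp s]
  calc _ ≤ Real.exp (-(m * s)) * ((1 - s) * Real.exp s) ^ m :=
        mul_le_mul_of_nonneg_left h1 (Real.exp_pos _).le
    _ = (1 - s) ^ m := by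
      rw [mul_pow, ← Real.exp_nat_mul, mul_left_comm, ← Real.exp_add]
      simp

theorem one_sub_pow_mul_le {s : ℝ} (h0 : 0 ≤ s) (hs : s ≤ 1) {m : ℕ} (hm : 1 ≤ m) :
    (1 - s) ^ m * ((m + 2) * s ^ 2 - 1) ≤ 8 / m - Real.exp (-(m * s)) := by
  have hm' : (1 : ℝ) ≤ m := by exact_mod_cast hm
  have h1 := one_sub_pow_le_exp hs m
  have h2 := exp_mul_one_sub_le_one_sub_pow h0 hs m
  have h3 : m * s ^ 2 * Real.exp (-(m * s)) ≤ 2 / m := by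
    rw [le_div_iff₀ (by linarith)]
    linarith [sq_mul_exp_neg_le_two (y := m * s) (by positivity)]
  have h4 : (1 - s) ^ m * ((m + 2) * s ^ 2) ≤ 3 * (m * s ^ 2 * Real.exp (-(m * s))) := by
    calc _ ≤ Real.exp (-(m * s)) * (3 * m * s ^ 2) := by
          gcongr
          linarith
      _ = _ := by ring
  have h5 : (8 : ℝ) / m = 4 * (2 / m) := by ring
  linarith

theorem gtCov_le {p : ℕ → ℝ} (hp : IsPMF p) (a : ℝ) {m : ℕ} (hm : 1 ≤ m) (w : ℕ × ℕ) :
    ((m + 2 : ℕ) : ℝ) * gtCov (m + 2) p w ≤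
      (if w.1 = w.2 then
        p w.1 * (Real.exp (-a) + a * Real.exp (-(m * p w.1)) + 3 / m) else 0) -
      p w.1 * Real.exp (-(m * p w.1)) * (p w.2 * Real.exp (-(m * p w.2))) +
      p w.1 * p w.2 * (8 / m) := by
  obtain ⟨u, v⟩ := w
  have hm' : (1 : ℝ) ≤ m := by exact_mod_cast hm
  have hn0 : ((m + 2 : ℕ) : ℝ) ≠ 0 := by positivity
  by_cases huv : u = v
  · subst huv
    simp only [gtCov, if_true, show m + 2 - 1 = m + 1 by omega]
    have h0 := hp.1 u
    have h1 := hp.le_one_s12 u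
    generalize p u = q at *
    have hx := one_sub_pow_le_exp h1 m
    have hx1 : Real.exp (-(m * q)) ≤ 1 := Real.exp_le_one_iff.2 (by nlinarith)
    have hqx : q * Real.exp (-(m * q)) ≤ 1 / m := by
      rw [le_div_iff₀ (by linarith)]
      linarith [mul_exp_neg_le_one (y := m * q)]
    have htan : (1 + m * q) * Real.exp (-(m * q)) ≤
        Real.exp (-a) + a * Real.exp (-(m * q)) := by
      have h : Real.exp (-a) = Real.exp (-(m * q)) * Real.exp (m * q - a) := by
        rw [← Real.exp_add]; ring_nf
      nlinarith [Real.add_one_le_exp (m * q - a), Real.exp_pos (-(m * q))]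
    have hpos := Real.exp_pos (-(m * q))
    set x := Real.exp (-(m * q))
    have e1 : (1 - q) ^ (m + 1) ≤ x :=
      (pow_le_pow_of_le_one (by linarith) (by linarith) (by omega)).trans hx
    have e2 : (1 - q) ^ (m + 2) ≤ x :=
      (pow_le_pow_of_le_one (by linarith) (by linarith) (by omega)).trans hx
    have e3 : ((m + 2 : ℕ) : ℝ) * (q * (1 - q) ^ (m + 1) / (m + 2 : ℕ) + q ^ 2 * (1 - q) ^ (m + 2))
        ≤ q * ((1 + m * q) * x + 2 * (q * x)) := by
      calc _ = q * ((1 - q) ^ (m + 1) + (m + 2) * q * (1 - q) ^ (m + 2)) := by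
            field_simp
            push_cast
            ring
        _ ≤ q * (x + (m + 2) * q * x) := by gcongr
        _ = _ := by ring
    have e4 : q * x * (q * x) ≤ q * (1 / m) := by
      calc _ ≤ (q * 1) * (1 / m) := by gcongr
        _ = _ := by ring
    have e5 : 0 ≤ q * q * (8 / m) := by positivity
    have e6 : q * ((1 + m * q) * x + 2 * (q * x)) ≤
        q * (Real.exp (-a) + a * x + 2 * (1 / m)) := by gcongr
    have e7 : (3 : ℝ) / m = 3 * (1 / m) := by ring
    rw [e7]
    linarith
  · simp only [gtCov, if_neg huv, Nat.add_sub_cancel]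
    have h := one_sub_pow_mul_le (add_nonneg (hp.1 u) (hp.1 v)) (hp.add_le_one_s12 huv) hm
    have hx : Real.exp (-(m * (p u + p v))) = Real.exp (-(m * p u)) * Real.exp (-(m * p v)) := by
      rw [← Real.exp_add]; ring_nf
    rw [hx] at h
    calc _ = p u * p v * ((1 - (p u + p v)) ^ m * ((m + 2) * (p u + p v) ^ 2 - 1)) := by
          rw [sub_sub]
          field_simp
          push_cast
          ring
      _ ≤ p u * p v * (8 / m - Real.exp (-(m * p u)) * Real.exp (-(m * p v))) :=
          mul_le_mul_of_nonneg_left h (mul_nonneg (hp.1 u) (hp.1 v))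
      _ = _ := by ring

theorem mul_risk_goodTuring_le {p : ℕ → ℝ} (hp : IsPMF p) (a : ℝ) {m : ℕ} (hm : 1 ≤ m) :
    ((m + 2 : ℕ) : ℝ) * risk (m + 2) p goodTuring ≤ Real.exp (-a) + a ^ 2 / 4 + 11 / m := by
  have hA : Summable fun u => p u * Real.exp (-(m * p u)) := by
    refine Summable.of_nonneg_of_le (fun u => mul_nonneg (hp.1 u) (Real.exp_pos _).le) (fun u => ?_)
      hp.2.summable
    refine mul_le_of_le_one_right (hp.1 u) (Real.exp_le_one_iff.2 ?_)
    exact neg_nonpos.2 (mul_nonneg m.cast_nonneg (hp.1 u))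
  obtain ⟨A, hA⟩ := hA
  have h0 : ∀ u, 0 ≤ p u * Real.exp (-(m * p u)) := fun u =>
    mul_nonneg (hp.1 u) (Real.exp_pos _).le
  have h1 : HasSum (fun u => p u * (Real.exp (-a) + a * Real.exp (-(m * p u)) + 3 / m))
      (1 * (Real.exp (-a) + 3 / m) + a * A) :=
    ((hp.2.mul_right _).add (hA.mul_left a)).congr_fun fun u => by ring
  have h2 := ((hasSum_diag h1).sub
    (hA.mul hA (hA.summable.mul_of_nonneg hA.summable h0 h0))).add
    ((hp.2.mul hp.2 (hp.2.summable.mul_of_nonneg hp.2.summable hp.1 hp.1)).mul_right (8 / (m : ℝ)))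
  have h3 := hasSum_le (gtCov_le hp a hm) ((hp.hasSum_gtCov (by omega)).mul_left _) h2
  have h4 : (11 : ℝ) / m = 3 / m + 8 / m := by ring
  nlinarith [sq_nonneg (A - a / 2)]

/-- The uniform distribution on `{0, …, K - 1}`. -/
def unifPMF (K : ℕ) (u : ℕ) : ℝ := if u < K then 1 / K else 0

theorem isPMF_unifPMF {K : ℕ} (hK : K ≠ 0) : IsPMF (unifPMF K) := by
  refine ⟨fun u => ?_, ?_⟩
  · unfold unifPMF; positivity
  · have h := hasSum_sum_of_ne_finset_zero (f := unifPMF K) (s := Finset.range K)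
      (L := .unconditional ℕ) fun u hu => if_neg (by simpa using hu)
    have h1 : ∑ u ∈ Finset.range K, unifPMF K u = 1 := by
      rw [Finset.sum_congr rfl fun u hu => show unifPMF K u = 1 / K from
        if_pos (Finset.mem_range.1 hu)]
      simp [hK]
    rwa [h1] at h

theorem le_gtCov_unifPMF {n K : ℕ} (hn : 2 ≤ n) (hK : 2 ≤ K) (w : ℕ × ℕ) :
    (if w.1 = w.2 then unifPMF K w.1 * ((1 - 1 / K) ^ n + n * (1 / K) * (1 - 1 / K) ^ n) else 0) -
      unifPMF K w.1 * unifPMF K w.2 * (1 - 2 / K) ^ (n - 2) ≤ n * gtCov n (unifPMF K) w := by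
  obtain ⟨u, v⟩ := w
  have hK' : (2 : ℝ) ≤ K := by exact_mod_cast hK
  have hn0 : (n : ℝ) ≠ 0 := by positivity
  have hq0 : (0 : ℝ) ≤ 1 / K := by positivity
  have hq2 : (0 : ℝ) ≤ 1 - 2 / K := sub_nonneg.2 ((div_le_one (by linarith)).2 hK')
  have h2q : (2 : ℝ) / K = 2 * (1 / K) := by ring
  have hE := pow_nonneg hq2 (n - 2)
  by_cases huv : u = v
  · subst huv
    simp only [gtCov, if_true]
    by_cases hu : u < K
    · simp only [unifPMF, if_pos hu]
      rw [h2q] at hq2 hE ⊢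
      generalize (1 : ℝ) / K = q at *
      have h1 : (1 - q) ^ n ≤ (1 - q) ^ (n - 1) :=
        pow_le_pow_of_le_one (by linarith) (by linarith) (by omega)
      have h2 : (n : ℝ) * (q * (1 - q) ^ (n - 1) / n + q ^ 2 * (1 - q) ^ n) =
        q * ((1 - q) ^ (n - 1) + n * q * (1 - q) ^ n) := by field_simp
      rw [h2]
      have h3 : q * ((1 - q) ^ n + n * q * (1 - q) ^ n) ≤
        q * ((1 - q) ^ (n - 1) + n * q * (1 - q) ^ n) := by gcongr
      have h4 := mul_nonneg (mul_nonneg hq0 hq0) hE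
      linarith
    · simp [unifPMF, hu]
  · simp only [gtCov, if_neg huv]
    by_cases hu : u < K
    · by_cases hv : v < K
      · simp only [unifPMF, if_pos hu, if_pos hv]
        rw [h2q] at hq2 hE ⊢
        generalize (1 : ℝ) / K = q at *
        have h1 : (n : ℝ) * (q * q * (1 - q - q) ^ (n - 2) * ((q + q) ^ 2 - 1 / n)) =
            n * (q * q * (1 - 2 * q) ^ (n - 2) * (2 * q) ^ 2) -
              q * q * (1 - 2 * q) ^ (n - 2) := by
          rw [show 1 - q - q = 1 - 2 * q by ring]
          field_simp
          ring
        rw [h1]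
        have h2 : 0 ≤ n * (q * q * (1 - 2 * q) ^ (n - 2) * (2 * q) ^ 2) := by positivity
        linarith
      · simp [unifPMF, hv]
    · simp [unifPMF, hu]

theorem le_mul_risk_unifPMF {n K : ℕ} (hn : 2 ≤ n) (hK : 2 ≤ K) :
    (1 - 1 / K : ℝ) ^ n + n * (1 / K) * (1 - 1 / K) ^ n - (1 - 2 / K) ^ (n - 2) ≤
      n * risk n (unifPMF K) goodTuring := by
  have hp := isPMF_unifPMF (K := K) (by omega)
  have h := ((hasSum_diag (hp.2.mul_right
    ((1 - 1 / K : ℝ) ^ n + n * (1 / K) * (1 - 1 / K) ^ n))).sub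
    ((hp.2.mul hp.2 (hp.2.summable.mul_of_nonneg hp.2.summable hp.1 hp.1)).mul_right
      ((1 - 2 / K : ℝ) ^ (n - 2))))
  have h1 := hasSum_le (le_gtCov_unifPMF hn hK) h ((hp.hasSum_gtCov hn).mul_left _)
  simpa using h1

theorem exp_neg_bounds :
    0.42741 ≤ Real.exp (-(17 / 20)) ∧ Real.exp (-(17 / 20)) ≤ 0.42742 := by
  have h := Real.exp_bound (x := -(17 / 20)) (by norm_num [abs_le]) (n := 10) (by norm_num)
  rw [abs_le] at h
  norm_num [Finset.sum_range_succ, Nat.factorial, abs_of_pos] at h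
  norm_num
  constructor <;> linarith [h.1, h.2]

theorem mul_gtWorstRisk_le {a : ℝ} {m : ℕ} (hm : 1 ≤ m) :
    ((m + 2 : ℕ) : ℝ) * gtWorstRisk (m + 2) ≤ Real.exp (-a) + a ^ 2 / 4 + 11 / m := by
  have hn : (0 : ℝ) < (m + 2 : ℕ) := by positivity
  rw [← le_div_iff₀' hn]
  refine csSup_le ⟨_, _, isPMF_unifPMF one_ne_zero, rfl⟩ ?_
  rintro r ⟨p, hp, rfl⟩
  exact (le_div_iff₀' hn).2 (mul_risk_goodTuring_le hp a hm)

theorem risk_le_gtWorstRisk {p : ℕ → ℝ} (hp : IsPMF p) {n : ℕ} (hn : 3 ≤ n) :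
    risk n p goodTuring ≤ gtWorstRisk n := by
  obtain ⟨m, rfl⟩ : ∃ m, n = m + 2 := ⟨n - 2, by omega⟩
  refine le_csSup ⟨(Real.exp (-0) + 0 ^ 2 / 4 + 11 / m) / (m + 2 : ℕ), ?_⟩ ⟨p, hp, rfl⟩
  rintro r ⟨p', hp', rfl⟩
  exact (le_div_iff₀' (by positivity)).2 (mul_risk_goodTuring_le hp' 0 (by omega))

theorem eventually_mul_gtWorstRisk_le :
    ∀ᶠ n : ℕ in Filter.atTop, (n : ℝ) * gtWorstRisk n ≤ 0.6179 := by
  filter_upwards [Filter.eventually_ge_atTop 2002] with n hn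
  obtain ⟨m, rfl⟩ : ∃ m, n = m + 2 := ⟨n - 2, by omega⟩
  refine (mul_gtWorstRisk_le (a := 17 / 20) (by omega)).trans ?_
  have hm : (2000 : ℝ) ≤ m := by exact_mod_cast (by omega : 2000 ≤ m)
  have h : (11 : ℝ) / m ≤ 11 / 2000 := by gcongr
  have := exp_neg_bounds.2
  norm_num at *
  linarith

theorem tendsto_unifPMF_lower_bound {K : ℕ → ℕ} {a : ℝ}
    (hK : Filter.Tendsto (fun n : ℕ => (n : ℝ) * (1 / K n)) Filter.atTop (nhds a)) :
    Filter.Tendsto (fun n : ℕ => (1 - 1 / K n : ℝ) ^ n + n * (1 / K n) * (1 - 1 / K n) ^ n -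
      (1 - 2 / K n) ^ (n - 2)) Filter.atTop
      (nhds (Real.exp (-a) + a * Real.exp (-a) - Real.exp (-(2 * a)))) := by
  have h1 : Filter.Tendsto (fun n : ℕ => (1 - 1 / K n : ℝ) ^ n) Filter.atTop
      (nhds (Real.exp (-a))) := by
    simpa only [sub_eq_add_neg] using Real.tendsto_one_add_pow_exp_of_tendsto
      (hK.neg.congr fun n => by ring)
  have h2 : Filter.Tendsto (fun n : ℕ => (1 - 2 / K n : ℝ) ^ n) Filter.atTop
      (nhds (Real.exp (-(2 * a)))) := by
    simpa only [sub_eq_add_neg] using Real.tendsto_one_add_pow_exp_of_tendsto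
      (g := fun n => -(2 / K n : ℝ)) ((hK.const_mul 2).neg.congr fun n => by ring)
  have h3 : Filter.Tendsto (fun n : ℕ => (1 - 2 / K n : ℝ)) Filter.atTop (nhds 1) := by
    have h := (hK.mul tendsto_one_div_atTop_nhds_zero_nat).const_mul 2
    have h' := h.const_sub 1
    simp only [mul_zero, sub_zero] at h'
    refine h'.congr' ?_
    filter_upwards [Filter.eventually_gt_atTop 0] with n hn
    field_simp
  refine (h1.add (hK.mul h1)).sub ?_
  have h4 := h2.div (h3.pow 2) (by norm_num)
  simp only [one_pow, div_one] at h4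
  refine h4.congr' ?_
  filter_upwards [Filter.eventually_ge_atTop 2, h3.eventually_ne one_ne_zero] with n hn hne
  obtain ⟨m, rfl⟩ : ∃ m, n = m + 2 := ⟨n - 2, by omega⟩
  rw [Nat.add_sub_cancel, Pi.div_apply, pow_add, mul_div_cancel_right₀ _ (pow_ne_zero 2 hne)]

theorem eventually_le_mul_gtWorstRisk :
    ∀ᶠ n : ℕ in Filter.atTop, 0.608 ≤ (n : ℝ) * gtWorstRisk n := by
  have hK : Filter.Tendsto (fun n : ℕ => (n : ℝ) * (1 / ⌈(20 / 17 : ℝ) * n⌉₊)) Filter.atTop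
      (nhds (17 / 20)) := by
    have h := ((tendsto_nat_ceil_mul_div_atTop (R := ℝ) (a := 20 / 17) (by norm_num)).comp
      tendsto_natCast_atTop_atTop).inv₀ (by norm_num)
    rw [inv_div] at h
    refine h.congr fun n => ?_
    simp [div_eq_mul_inv]
  have h1 := tendsto_unifPMF_lower_bound hK
  have h2 : 0.608 < Real.exp (-(17 / 20)) + 17 / 20 * Real.exp (-(17 / 20)) -
      Real.exp (-(2 * (17 / 20))) := by
    rw [show -(2 * (17 / 20) : ℝ) = -(17 / 20) + -(17 / 20) by ring, Real.exp_add]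
    obtain ⟨h3, h4⟩ := exp_neg_bounds
    norm_num at *
    nlinarith
  filter_upwards [h1.eventually_const_lt h2, Filter.eventually_ge_atTop 3] with n h3 hn
  have hn' : (3 : ℝ) ≤ n := by exact_mod_cast hn
  have hK2 : 2 ≤ ⌈(20 / 17 : ℝ) * n⌉₊ := by
    have := Nat.le_ceil ((20 / 17 : ℝ) * n)
    exact_mod_cast (by linarith : (2 : ℝ) ≤ (⌈(20 / 17 : ℝ) * n⌉₊ : ℝ))
  refine h3.le.trans ((le_mul_risk_unifPMF (by omega) hK2).trans ?_)
  exact mul_le_mul_of_nonneg_left (risk_le_gtWorstRisk (isPMF_unifPMF (by omega)) hn) n.cast_nonneg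

/-- **Theorem 2 (worst-case risk of the Good-Turing estimator):**
`0.608 ≤ liminf_{n→∞} n · sup_p R_n(M^GT, p)` and
`limsup_{n→∞} n · sup_p R_n(M^GT, p) ≤ 0.6179`. -/
theorem goodTuring_worst_risk_bounds :
    0.608 ≤ Filter.liminf (fun n : ℕ => (n : ℝ) * gtWorstRisk n) Filter.atTop ∧
    Filter.limsup (fun n : ℕ => (n : ℝ) * gtWorstRisk n) Filter.atTop ≤ 0.6179 := by
  have hle := eventually_mul_gtWorstRisk_le
  have hge := eventually_le_mul_gtWorstRisk
  exact ⟨Filter.le_liminf_of_le (Filter.isBoundedUnder_of_eventually_le hle).isCoboundedUnder_ge hge,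
    Filter.limsup_le_of_le (Filter.isBoundedUnder_of_eventually_ge hge).isCoboundedUnder_le hle⟩
end
end
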